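/- For every μ ∈ (0, 1), 2 l_{μ−1}'(1) = μ ∫₀¹ (1 − t)^{μ−1} (2 cos t − t sin t) dt, and consequently l_{μ−1}'(1) > 0. Here l_{μ−1} denotes the normalized Lommel function of the first kind with parameter μ − 1 ∈ (−1, 0). -/

import Mathlib

noncomputable section

/-- The normalized Lommel function of the first kind (real restriction),
`l_μ(x) = ∑ (−1)^n Γ(μ/2+1) Γ(μ/2+3/2) x^(n+1) / (4^n Γ(μ/2+n+1) Γ(μ/2+n+3/2))`. -/
def lommelLR (μ : ℝ) (x : ℝ) : ℝ :=
  ∑' n : ℕ, ((-1 : ℝ) ^ n * Real.Gamma (μ / 2 + 1) * Real.Gamma (μ / 2 + 3 / 2) * x ^ (n + 1)) /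
    (4 ^ n * Real.Gamma (μ / 2 + n + 1) * Real.Gamma (μ / 2 + n + 3 / 2))

open MeasureTheory Set
open scoped Nat

/-- Legendre duplication simplifies the coefficients of the Lommel series. -/
lemma lommelLR_sub_one_eq_tsum {μ : ℝ} (hμ : 0 < μ) (x : ℝ) :
    lommelLR (μ - 1) x =
      ∑' n : ℕ, (-1 : ℝ) ^ n * (Real.Gamma (μ + 1) / Real.Gamma (μ + 1 + 2 * n)) * x ^ (n + 1) := by
  refine tsum_congr fun n => ?_
  have h0 := Real.Gamma_mul_Gamma_add_half (μ / 2 + 1 / 2)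
  have hn := Real.Gamma_mul_Gamma_add_half (μ / 2 + n + 1 / 2)
  rw [show μ / 2 + 1 / 2 + 1 / 2 = μ / 2 + 1 by ring,
    show 2 * (μ / 2 + 1 / 2) = μ + 1 by ring] at h0
  rw [show μ / 2 + n + 1 / 2 + 1 / 2 = μ / 2 + n + 1 by ring,
    show 2 * (μ / 2 + n + 1 / 2) = μ + 1 + 2 * n by ring] at hn
  have hpow : (2 : ℝ) ^ (1 - (μ + 1)) = 4 ^ n * 2 ^ (1 - (μ + 1 + 2 * n)) := by
    rw [show (4 : ℝ) = 2 ^ (2 : ℝ) by norm_num, ← Real.rpow_natCast, ← Real.rpow_mul (by norm_num),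
      ← Real.rpow_add (by norm_num)]
    congr 1
    ring
  have hG : Real.Gamma (μ + 1 + 2 * n) ≠ 0 := (Real.Gamma_pos_of_pos (by positivity)).ne'
  have hp : (2 : ℝ) ^ (1 - (μ + 1 + 2 * n)) ≠ 0 := (Real.rpow_pos_of_pos (by norm_num) _).ne'
  have hpi : √Real.pi ≠ 0 := (Real.sqrt_pos.2 Real.pi_pos).ne'
  rw [show (μ - 1) / 2 + 1 = μ / 2 + 1 / 2 by ring, show (μ - 1) / 2 + 3 / 2 = μ / 2 + 1 by ring,
    show (μ - 1) / 2 + n + 1 = μ / 2 + n + 1 / 2 by ring,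
    show (μ - 1) / 2 + n + 3 / 2 = μ / 2 + n + 1 by ring,
    mul_assoc ((-1 : ℝ) ^ n), h0, mul_assoc ((4 : ℝ) ^ n), hn, hpow]
  field_simp

lemma Gamma_mul_factorial_le_Gamma {a : ℝ} (ha : 0 ≤ a) (m : ℕ) :
    Real.Gamma (a + 1) * m ! ≤ Real.Gamma (a + 1 + m) := by
  induction m with
  | zero => simp
  | succ m ih =>
    have h : 0 < a + 1 + m := by positivity
    push_cast [Nat.factorial_succ]
    rw [← add_assoc, Real.Gamma_add_one h.ne']
    have h1 : 0 < Real.Gamma (a + 1) := Real.Gamma_pos_of_pos (by positivity)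
    calc Real.Gamma (a + 1) * ((m + 1) * m !) = (m + 1) * (Real.Gamma (a + 1) * m !) := by ring
      _ ≤ (a + 1 + m) * Real.Gamma (a + 1 + m) :=
        mul_le_mul (by linarith) ih (by positivity) h.le

lemma summable_add_one_mul_two_pow_div_factorial :
    Summable fun n : ℕ => ((n : ℝ) + 1) * 2 ^ n / (2 * n)! := by
  refine Summable.of_nonneg_of_le (fun n => by positivity) (fun n => ?_)
    (Real.summable_pow_div_factorial 4)
  have h1 : (n : ℝ) + 1 ≤ 2 ^ n := by exact_mod_cast Nat.lt_two_pow_self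
  have h2 : n ! ≤ (2 * n)! := Nat.factorial_le (by omega)
  have h3 : (4 : ℝ) ^ n = 2 ^ n * 2 ^ n := by rw [← mul_pow]; norm_num
  rw [h3]
  gcongr

lemma hasDerivAt_lommelLR_sub_one {μ : ℝ} (hμ : 0 < μ) :
    HasDerivAt (lommelLR (μ - 1))
      (∑' n : ℕ, (-1 : ℝ) ^ n * (Real.Gamma (μ + 1) / Real.Gamma (μ + 1 + 2 * n)) * (n + 1)) 1 := by
  have hc (n : ℕ) : |Real.Gamma (μ + 1) / Real.Gamma (μ + 1 + 2 * n)| ≤ 1 / (2 * n)! := by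
    have h1 : 0 < Real.Gamma (μ + 1) := Real.Gamma_pos_of_pos (by positivity)
    have h2 : 0 < Real.Gamma (μ + 1 + 2 * n) := Real.Gamma_pos_of_pos (by positivity)
    have h3 := Gamma_mul_factorial_le_Gamma hμ.le (2 * n)
    push_cast at h3
    rw [abs_of_pos (div_pos h1 h2), div_le_div_iff₀ h2 (by positivity), one_mul]
    exact h3
  have key := hasDerivAt_tsum_of_isPreconnected (𝕜 := ℝ)
    (g := fun (n : ℕ) x =>
      (-1 : ℝ) ^ n * (Real.Gamma (μ + 1) / Real.Gamma (μ + 1 + 2 * n)) * x ^ (n + 1))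
    (g' := fun (n : ℕ) x =>
      (-1 : ℝ) ^ n * (Real.Gamma (μ + 1) / Real.Gamma (μ + 1 + 2 * n)) * ((n + 1) * x ^ n))
    (t := Ioo (-2) 2) (y₀ := 0) (y := 1)
    summable_add_one_mul_two_pow_div_factorial isOpen_Ioo isPreconnected_Ioo
    (fun n y _ => by
      simpa using (hasDerivAt_pow (n + 1) y).const_mul
        ((-1 : ℝ) ^ n * (Real.Gamma (μ + 1) / Real.Gamma (μ + 1 + 2 * n))))
    (fun n y hy => by
      have hy' : |y| ≤ 2 := abs_le.2 ⟨hy.1.le, hy.2.le⟩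
      have hn : |(n : ℝ) + 1| = n + 1 := abs_of_pos (by positivity)
      rw [Real.norm_eq_abs, abs_mul, abs_mul, abs_mul, abs_pow, abs_pow, abs_neg, abs_one,
        one_pow, one_mul, hn]
      calc _ ≤ 1 / ((2 * n)! : ℝ) * ((n + 1) * 2 ^ n) := by
            gcongr
            exact hc n
        _ = _ := by ring)
    (by norm_num) (by simp) (by norm_num)
  simp only [one_pow, mul_one] at key
  exact key.congr_of_eventuallyEq (.of_forall fun x => lommelLR_sub_one_eq_tsum hμ x)

lemma integral_one_sub_rpow_mul_pow {μ : ℝ} (hμ : 0 < μ) (k : ℕ) :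
    ∫ t in (0 : ℝ)..1, (1 - t) ^ (μ - 1) * t ^ k =
      Real.Gamma μ * k ! / Real.Gamma (μ + 1 + k) := by
  have h := ProbabilityTheory.beta_eq_betaIntegralReal (k + 1) μ (by positivity) hμ
  have h2 : Complex.betaIntegral ((k + 1 : ℝ) : ℂ) μ =
      ((∫ t in (0 : ℝ)..1, (1 - t) ^ (μ - 1) * t ^ k : ℝ) : ℂ) := by
    rw [Complex.betaIntegral, ← intervalIntegral.integral_ofReal]
    refine intervalIntegral.integral_congr fun t ht => ?_
    rw [uIcc_of_le zero_le_one] at ht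
    have : 0 ≤ 1 - t := by linarith [ht.2]
    push_cast [Complex.ofReal_cpow this]
    rw [add_sub_cancel_right, Complex.cpow_natCast, mul_comm]
  rw [h2, Complex.ofReal_re, ProbabilityTheory.beta, Real.Gamma_nat_eq_factorial] at h
  rw [← h, mul_comm (Real.Gamma μ)]
  congr 2
  ring

lemma hasSum_two_mul_cos_sub_mul_sin (t : ℝ) :
    HasSum (fun n : ℕ => (-1 : ℝ) ^ n * (2 * n + 2) * t ^ (2 * n) / (2 * n)!)
      (2 * Real.cos t - t * Real.sin t) := by
  have h1 := (Real.hasSum_cos t).mul_left 2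
  have h2 : HasSum (fun n : ℕ => (-1 : ℝ) ^ n * (2 * n) * t ^ (2 * n) / (2 * n)!)
      (-t * Real.sin t) := by
    have h3 := (Real.hasSum_sin t).mul_left (-t)
    rw [← hasSum_nat_add_iff' 1]
    simp only [Finset.sum_range_one, Nat.cast_zero, mul_zero, zero_mul, zero_div, sub_zero]
    refine h3.congr_fun fun n => ?_
    rw [show 2 * (n + 1) = (2 * n + 1) + 1 by ring, Nat.factorial_succ (2 * n + 1)]
    have : ((2 * n + 1)! : ℝ) ≠ 0 := by positivity
    push_cast
    field_simp
    ring
  rw [show 2 * Real.cos t - t * Real.sin t = 2 * Real.cos t + -t * Real.sin t by ring]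
  exact (h1.add h2).congr_fun fun n => by ring

lemma intervalIntegrable_one_sub_rpow {μ : ℝ} (hμ : 0 < μ) :
    IntervalIntegrable (fun t : ℝ => (1 - t) ^ (μ - 1)) volume 0 1 := by
  have h := (intervalIntegral.intervalIntegrable_rpow' (a := 0) (b := 1)
    (show -1 < μ - 1 by linarith)).comp_sub_left 1
  simpa using h.symm

lemma hasSum_integral_one_sub_rpow {μ : ℝ} (hμ : 0 < μ) :
    HasSum (fun n : ℕ => ∫ t in (0 : ℝ)..1,
        (1 - t) ^ (μ - 1) * ((-1 : ℝ) ^ n * (2 * n + 2) * t ^ (2 * n) / (2 * n)!))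
      (∫ t in (0 : ℝ)..1, (1 - t) ^ (μ - 1) * (2 * Real.cos t - t * Real.sin t)) := by
  have hs : Summable fun n : ℕ => (2 * (n : ℝ) + 2) / (2 * n)! := by
    refine Summable.of_nonneg_of_le (fun n => by positivity) (fun n => ?_)
      (summable_add_one_mul_two_pow_div_factorial.mul_left 2)
    rw [← mul_div_assoc]
    gcongr
    have : (1 : ℝ) ≤ 2 ^ n := one_le_pow₀ (by norm_num)
    nlinarith [(Nat.cast_nonneg n : (0 : ℝ) ≤ n)]
  refine intervalIntegral.hasSum_integral_of_dominated_convergence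
    (fun (n : ℕ) t => (1 - t) ^ (μ - 1) * ((2 * (n : ℝ) + 2) / (2 * n)!)) (fun n => ?_)
    (fun n => ?_) ?_ ?_ ?_
  · exact Measurable.aestronglyMeasurable (by fun_prop)
  · refine .of_forall fun t ht => ?_
    rw [uIoc_of_le zero_le_one] at ht
    have h1 : 0 ≤ (1 - t) ^ (μ - 1) := Real.rpow_nonneg (by linarith [ht.2]) _
    have h2 : t ^ (2 * n) ≤ 1 := pow_le_one₀ ht.1.le ht.2
    have h3 : |2 * (n : ℝ) + 2| = 2 * n + 2 := abs_of_pos (by positivity)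
    rw [Real.norm_eq_abs, abs_mul, abs_of_nonneg h1, abs_div, abs_mul, abs_mul, abs_pow, abs_neg,
      abs_one, one_pow, one_mul, h3, abs_of_nonneg (pow_nonneg ht.1.le _), Nat.abs_cast]
    gcongr
    exact mul_le_of_le_one_right (by positivity) h2
  · exact .of_forall fun t _ => hs.mul_left _
  · simp_rw [tsum_mul_left]
    exact (intervalIntegrable_one_sub_rpow hμ).mul_const _
  · exact .of_forall fun t _ => (hasSum_two_mul_cos_sub_mul_sin t).mul_left _

lemma integral_one_sub_rpow_mul_pos {μ : ℝ} (hμ : 0 < μ) :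
    0 < ∫ t in (0 : ℝ)..1, (1 - t) ^ (μ - 1) * (2 * Real.cos t - t * Real.sin t) := by
  refine intervalIntegral.intervalIntegral_pos_of_pos_on
    ((intervalIntegrable_one_sub_rpow hμ).mul_continuousOn (by fun_prop)) (fun t ht => ?_)
    zero_lt_one
  have h1 := Real.one_sub_sq_div_two_le_cos (x := t)
  have h2 := Real.sin_le ht.1.le
  refine mul_pos (Real.rpow_pos_of_pos (by linarith [ht.2]) _) ?_
  nlinarith [ht.1, ht.2]

/-- For `μ ∈ (0,1)`, `2 l_{μ−1}'(1) = μ ∫₀¹ (1 − t)^(μ−1) (2 cos t − t sin t) dt`, and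
consequently `l_{μ−1}'(1) > 0`. -/
theorem lommelL_deriv_one_shifted (μ : ℝ) (hμ₀ : 0 < μ) (hμ₁ : μ < 1) :
    2 * deriv (lommelLR (μ - 1)) 1 =
      μ * ∫ t in (0 : ℝ)..1, (1 - t) ^ (μ - 1) * (2 * Real.cos t - t * Real.sin t) ∧
    0 < deriv (lommelLR (μ - 1)) 1 := by
  have key : 2 * deriv (lommelLR (μ - 1)) 1 =
      μ * ∫ t in (0 : ℝ)..1, (1 - t) ^ (μ - 1) * (2 * Real.cos t - t * Real.sin t) := by
    rw [(hasDerivAt_lommelLR_sub_one hμ₀).deriv, ← (hasSum_integral_one_sub_rpow hμ₀).tsum_eq,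
      ← tsum_mul_left, ← tsum_mul_left]
    refine tsum_congr fun n => ?_
    have h := integral_one_sub_rpow_mul_pow hμ₀ (2 * n)
    have h1 (t : ℝ) :
        (1 - t) ^ (μ - 1) * ((-1 : ℝ) ^ n * (2 * n + 2) * t ^ (2 * n) / (2 * n)!) =
          ((-1 : ℝ) ^ n * (2 * n + 2) / (2 * n)!) * ((1 - t) ^ (μ - 1) * t ^ (2 * n)) := by
      ring
    simp_rw [h1]
    rw [intervalIntegral.integral_const_mul, h, Real.Gamma_add_one hμ₀.ne']
    have : ((2 * n)! : ℝ) ≠ 0 := by positivity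
    push_cast
    field_simp
  refine ⟨key, ?_⟩
  have := mul_pos hμ₀ (integral_one_sub_rpow_mul_pos hμ₀)
  linarith
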